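/- arXiv:2211.05314 — 2 statements merged into one kernel-verified Lean document; each statement's English description precedes it below -/
import Mathlib

section
/- Let M = E[W_B] be the expected weight matrix of the three-community stochastic block model. Then there is a unit eigenvector v_γ of M corresponding to its third largest eigenvalue λ_3(M), with sign chosen so that ⟨v_γ, e_γ⟩ ≥ 0, such that ||v_γ − (1/√s) e_γ||_2 ≤ √(8 s / l). -/
open Matrix

/-- Euclidean norm of a vector in ℝⁿ. -/
noncomputable def euclNorm {n : ℕ} (v : Fin n → ℝ) : ℝ :=
  Real.sqrt (∑ i, (v i) ^ 2)

/-- The `k`-th largest eigenvalue (1-indexed, counted with multiplicity) of a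
real symmetric matrix; junk value `0` if the matrix is not symmetric. -/
noncomputable def kthLargestEig {n : ℕ} (A : Matrix (Fin n) (Fin n) ℝ) (k : ℕ) : ℝ :=
  if hA : A.IsHermitian then
    ((List.ofFn hA.eigenvalues).mergeSort (fun a b => decide (b ≤ a))).getD (k - 1) 0
  else 0

/-- Community assignment for the three-community model on {0, …, 2l+s-1}:
α = {0,…,l-1}, β = {l,…,2l-1}, γ = {2l,…,2l+s-1}. -/
def commB (l : ℕ) {n : ℕ} (i : Fin n) : ℕ :=
  if (i : ℕ) < l then 0 else if (i : ℕ) < 2 * l then 1 else 2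

/-- Expected weight matrix `E[W_B]` of the three-community stochastic block model. -/
noncomputable def thetaB (p q : ℝ) (l : ℕ) (n : ℕ) : Matrix (Fin n) (Fin n) ℝ :=
  Matrix.of fun i j => if commB l i = commB l j then p else q

/-- Indicator vector of the community γ = {2l, …, n-1}. -/
def indGamma (l : ℕ) (n : ℕ) : Fin n → ℝ := fun i => if 2 * l ≤ (i : ℕ) then 1 else 0

theorem kthLargestEig_eq_getD_of_roots_charpoly {n : ℕ} {A : Matrix (Fin n) (Fin n) ℝ}
    (hA : A.IsHermitian) {L : List ℝ} (hL : L.Pairwise (fun a b => b ≤ a))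
    (h : A.charpoly.roots = (L : Multiset ℝ)) (k : ℕ) :
    kthLargestEig A k = L.getD (k - 1) 0 := by
  have hperm : (List.ofFn hA.eigenvalues).Perm L := by
    rw [← Multiset.coe_eq_coe, ← h, hA.roots_charpoly_eq_eigenvalues, Fin.univ_val_map]
    rfl
  have hsort : ((List.ofFn hA.eigenvalues).mergeSort (fun a b => decide (b ≤ a))).Pairwise
      (fun a b => b ≤ a) := by
    simpa using List.pairwise_mergeSort (le := fun a b : ℝ => decide (b ≤ a))
      (fun a b c hab hbc => by simp only [decide_eq_true_eq] at *; exact hbc.trans hab)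
      (fun a b => by simpa using le_total b a) (List.ofFn hA.eigenvalues)
  rw [kthLargestEig, dif_pos hA, List.Perm.eq_of_pairwise (fun a b _ _ hab hba => le_antisymm hba hab)
    hsort hL ((List.mergeSort_perm _ _).trans hperm)]

theorem sum_comp_commB (l s : ℕ) (g : ℕ → ℝ) :
    ∑ i : Fin (2 * l + s), g (commB l i) = l * g 0 + l * g 1 + s * g 2 := by
  have h := Fin.sum_univ_eq_sum_range
    (fun i => g (if i < l then 0 else if i < 2 * l then 1 else 2)) (2 * l + s)
  have hα : ∑ i ∈ Finset.range l, g (if i < l then 0 else if i < 2 * l then 1 else 2) = l * g 0 := by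
    rw [Finset.sum_congr rfl (g := fun _ => g 0)]
    · simp
    · intro i hi
      simp [Finset.mem_range.mp hi]
  have hβ : ∑ i ∈ Finset.range l,
      g (if l + i < l then 0 else if l + i < 2 * l then 1 else 2) = l * g 1 := by
    rw [Finset.sum_congr rfl (g := fun _ => g 1)]
    · simp
    · intro i hi
      have : l + i < 2 * l := by have := Finset.mem_range.mp hi; omega
      simp [this]
  have hγ : ∑ i ∈ Finset.range s,
      g (if 2 * l + i < l then 0 else if 2 * l + i < 2 * l then 1 else 2) = s * g 2 := by
    rw [Finset.sum_congr rfl (g := fun _ => g 2)]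
    · simp
    · intro i _
      have h₁ : ¬ 2 * l + i < l := by omega
      have h₂ : ¬ 2 * l + i < 2 * l := by omega
      simp only [h₁, h₂, if_false]
  rw [two_mul l, Finset.sum_range_add, Finset.sum_range_add, ← two_mul l] at h
  simp only [commB]
  rw [h, hα, hβ, hγ]

theorem commB_le_two (l : ℕ) {n : ℕ} (i : Fin n) : commB l i ≤ 2 := by
  unfold commB
  split_ifs <;> omega

theorem indGamma_eq_ite_commB (l : ℕ) {n : ℕ} (i : Fin n) :
    indGamma l n i = if commB l i = 2 then 1 else 0 := by
  unfold indGamma commB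
  split_ifs <;> simp_all <;> omega

/-- Community membership matrix. -/
def membershipB (l n : ℕ) : Matrix (Fin n) (Fin 3) ℝ :=
  Matrix.of fun i k => if commB l i = (k : ℕ) then 1 else 0

/-- Connection probabilities between the three communities. -/
def blockB (p q : ℝ) : Matrix (Fin 3) (Fin 3) ℝ :=
  !![p, q, q; q, p, q; q, q, p]

theorem thetaB_eq_membershipB_mul (p q : ℝ) (l n : ℕ) :
    thetaB p q l n = membershipB l n * (blockB p q * (membershipB l n)ᵀ) := by
  ext i j
  have hi := commB_le_two l i
  have hj := commB_le_two l j
  simp only [thetaB, membershipB, blockB, Matrix.mul_apply, Fin.sum_univ_three, Matrix.of_apply,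
    Matrix.transpose_apply]
  generalize commB l i = a at *
  generalize commB l j = b at *
  interval_cases a <;> interval_cases b <;> simp

theorem transpose_membershipB_mul_self (l s : ℕ) :
    (membershipB l (2 * l + s))ᵀ * membershipB l (2 * l + s) =
      Matrix.diagonal ![(l : ℝ), l, s] := by
  ext a b
  simp only [membershipB, Matrix.mul_apply, Matrix.of_apply, Matrix.transpose_apply]
  rw [sum_comp_commB l s
    (fun c => (if c = (a : ℕ) then 1 else 0) * (if c = (b : ℕ) then 1 else 0))]
  fin_cases a <;> fin_cases b <;> simp

theorem charpoly_blockB_mul_diagonal (p q x y : ℝ) {m₁ m₂ : ℝ}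
    (hsum : m₁ + m₂ = x * (p + q) + y * p) (hprod : m₁ * m₂ = x * y * ((p - q) * (p + 2 * q))) :
    (blockB p q * Matrix.diagonal ![x, x, y]).charpoly =
      (Polynomial.X - Polynomial.C m₁) * (Polynomial.X - Polynomial.C (x * (p - q))) *
        (Polynomial.X - Polynomial.C m₂) := by
  have hs := congrArg Polynomial.C hsum
  have hp := congrArg Polynomial.C hprod
  simp only [map_add, map_mul, map_sub, map_ofNat] at hs hp
  rw [Matrix.charpoly, Matrix.det_fin_three]
  simp only [Matrix.charmatrix_apply, blockB, Matrix.mul_diagonal]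
  simp
  linear_combination (Polynomial.X - Polynomial.C x * (Polynomial.C p - Polynomial.C q)) *
    (Polynomial.X * hs - hp)

theorem roots_charpoly_thetaB (p q : ℝ) (l s : ℕ) (hn : 3 ≤ 2 * l + s) {m₁ m₂ : ℝ}
    (hsum : m₁ + m₂ = l * (p + q) + s * p) (hprod : m₁ * m₂ = l * s * ((p - q) * (p + 2 * q))) :
    (thetaB p q l (2 * l + s)).charpoly.roots =
      (([m₁, l * (p - q), m₂] ++ List.replicate (2 * l + s - 3) 0 : List ℝ) : Multiset ℝ) := by
  have h := Matrix.charpoly_mul_comm' (membershipB l (2 * l + s))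
    (blockB p q * (membershipB l (2 * l + s))ᵀ)
  rw [← thetaB_eq_membershipB_mul, Matrix.mul_assoc, transpose_membershipB_mul_self,
    charpoly_blockB_mul_diagonal p q l s hsum hprod, Fintype.card_fin, Fintype.card_fin] at h
  obtain ⟨k, hk⟩ := Nat.exists_eq_add_of_le hn
  have hpoly : (thetaB p q l (2 * l + s)).charpoly = Polynomial.X ^ k *
      ((Polynomial.X - Polynomial.C m₁) * (Polynomial.X - Polynomial.C (l * (p - q))) *
        (Polynomial.X - Polynomial.C m₂)) := by
    apply mul_left_cancel₀ (pow_ne_zero 3 (Polynomial.X_ne_zero (R := ℝ)))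
    rw [h, ← mul_assoc (_ ^ 3), ← pow_add, ← hk]
  have h₁ := Polynomial.X_sub_C_ne_zero m₁
  have h₂ := Polynomial.X_sub_C_ne_zero ((l : ℝ) * (p - q))
  have h₃ := Polynomial.X_sub_C_ne_zero m₂
  rw [hpoly, Polynomial.roots_mul
    (mul_ne_zero (pow_ne_zero _ Polynomial.X_ne_zero) (mul_ne_zero (mul_ne_zero h₁ h₂) h₃)),
    Polynomial.roots_mul (mul_ne_zero (mul_ne_zero h₁ h₂) h₃),
    Polynomial.roots_mul (mul_ne_zero h₁ h₂), Polynomial.roots_X_pow]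
  simp only [Polynomial.roots_X_sub_C]
  have hk' : 2 * l + s - 3 = k := by omega
  rw [hk', ← Multiset.coe_add, add_comm, Multiset.coe_replicate, Multiset.nsmul_singleton]
  rfl

theorem isHermitian_thetaB (p q : ℝ) (l n : ℕ) : (thetaB p q l n).IsHermitian := by
  ext i j
  simp [thetaB, eq_comm]

theorem exists_kthLargestEig_thetaB_three {p q : ℝ} {l s : ℕ}
    (hq : 0 < q) (hpq : q < p) (hs : 0 < s) (hsl : s < l) :
    ∃ m : ℝ, kthLargestEig (thetaB p q l (2 * l + s)) 3 = m ∧ m < l * (p - q) ∧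
      (m - l * (p + q)) * (m - s * p) = 2 * l * s * q ^ 2 := by
  have hs' : (0 : ℝ) < s := by exact_mod_cast hs
  have hsl' : (s : ℝ) < l := by exact_mod_cast hsl
  have hl' : (0 : ℝ) < l := hs'.trans hsl'
  have hp : 0 < p := hq.trans hpq
  have hd : 0 < p - q := sub_pos.mpr hpq
  set r := Real.sqrt ((l * (p + q) - s * p) ^ 2 + 8 * l * s * q ^ 2)
  have hr : r ^ 2 = (l * (p + q) - s * p) ^ 2 + 8 * l * s * q ^ 2 := Real.sq_sqrt (by positivity)
  have hr0 : 0 ≤ r := Real.sqrt_nonneg _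
  obtain ⟨m₁, hm₁⟩ : ∃ m₁, m₁ = (l * (p + q) + s * p + r) / 2 := ⟨_, rfl⟩
  obtain ⟨m₂, hm₂⟩ : ∃ m₂, m₂ = (l * (p + q) + s * p - r) / 2 := ⟨_, rfl⟩
  have hsum : m₁ + m₂ = l * (p + q) + s * p := by rw [hm₁, hm₂]; ring
  have hprod : m₁ * m₂ = l * s * ((p - q) * (p + 2 * q)) := by
    rw [hm₁, hm₂]; linear_combination (-1 / 4) * hr
  have hle : m₂ ≤ m₁ := by linarith
  have hneg : (l * (p - q) - m₁) * (l * (p - q) - m₂) < 0 := by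
    have h₁ : (l * (p - q) - m₁) * (l * (p - q) - m₂) = -(2 * l * q * (l - s) * (p - q)) := by
      linear_combination hprod - l * (p - q) * hsum
    have h₂ : 0 < (l : ℝ) - s := sub_pos.mpr hsl'
    rw [h₁]
    exact neg_neg_of_pos (by positivity)
  have hlt : m₂ < l * (p - q) := by
    by_contra! h
    nlinarith
  have hgt : l * (p - q) < m₁ := by
    by_contra! h
    nlinarith
  have hm₁0 : 0 < m₁ := lt_trans (by positivity) hgt
  have hm₂0 : 0 < m₂ := by
    refine pos_of_mul_pos_right (a := m₁) ?_ hm₁0.le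
    rw [hprod]; positivity
  refine ⟨m₂, ?_, hlt, by linear_combination m₂ * hsum - hprod⟩
  rw [kthLargestEig_eq_getD_of_roots_charpoly (isHermitian_thetaB p q l _) ?_
    (roots_charpoly_thetaB p q l s (by omega) hsum hprod)]
  · simp
  · have h₀ : 0 < l * (p - q) := by positivity
    simp [List.pairwise_replicate, hlt.le, hgt.le, hle, hm₁0.le, hm₂0.le,
      h₀.le]

/-- Lemma 1, first part: the expected weight matrix `M = E[W_B]` of the
three-community SBM has a unit eigenvector `v_γ` for its third largest eigenvalue, with
sign chosen so that `⟨v_γ, e_γ⟩ ≥ 0`, satisfying `‖v_γ - (1/√s) e_γ‖ ≤ √(8 s / l)`. -/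
theorem expected_WB_third_eigenvector (p q : ℝ) (l s : ℕ)
    (hq : 0 < q) (hpq : q < p) (hp : p ≤ 1) (hs : 0 < s) (hsl : s < l) :
    ∃ v : Fin (2 * l + s) → ℝ,
      euclNorm v = 1 ∧
      (thetaB p q l (2 * l + s)).mulVec v = kthLargestEig (thetaB p q l (2 * l + s)) 3 • v ∧
      0 ≤ ∑ i, v i * indGamma l (2 * l + s) i ∧
      euclNorm (v - (1 / Real.sqrt s) • indGamma l (2 * l + s)) ≤
        Real.sqrt (8 * s / l) := by
  obtain ⟨m, hm, hlt, hroot⟩ := exists_kthLargestEig_thetaB_three hq hpq hs hsl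
  have hs' : (0 : ℝ) < s := by exact_mod_cast hs
  have hl' : (0 : ℝ) < l := by exact_mod_cast hs.trans hsl
  have hden : 2 * l * q < l * (p + q) - m := by linarith
  have hden0 : 0 < l * (p + q) - m := lt_trans (by positivity) hden
  -- The unnormalised eigenvector is `a` on the two large communities and `1` on `γ`.
  obtain ⟨a, ha⟩ : ∃ a, a = -(s * q) / (l * (p + q) - m) := ⟨_, rfl⟩
  have ha' : a * (l * (p + q) - m) = -(s * q) := by rw [ha]; field_simp
  have ha2 : 4 * l ^ 2 * a ^ 2 ≤ s ^ 2 := by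
    have h₁ : (a * (2 * l * q)) ^ 2 ≤ (a * (l * (p + q) - m)) ^ 2 := by
      rw [mul_pow a, mul_pow a]
      exact mul_le_mul_of_nonneg_left (pow_le_pow_left₀ (by positivity) hden.le 2) (sq_nonneg a)
    rw [ha'] at h₁
    have h₂ : 0 < q ^ 2 := by positivity
    nlinarith
  have hγ : 2 * l * q * a + s * p = m := by
    apply mul_right_cancel₀ hden0.ne'
    linear_combination 2 * l * q * ha' + hroot
  obtain ⟨N, hN⟩ : ∃ N, N = Real.sqrt (2 * l * a ^ 2 + s) := ⟨_, rfl⟩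
  have hNpos : 0 < N := by rw [hN]; positivity
  have hNsq : N ^ 2 = 2 * l * a ^ 2 + s := by rw [hN]; exact Real.sq_sqrt (by positivity)
  have hR : 0 < Real.sqrt s := Real.sqrt_pos.mpr hs'
  have hRsq : Real.sqrt s ^ 2 = s := Real.sq_sqrt hs'.le
  set R := Real.sqrt s
  have hnorm : l * (a / N) ^ 2 + l * (a / N) ^ 2 + s * (1 / N) ^ 2 = 1 := by
    field_simp
    linarith
  refine ⟨fun i => (if commB l i = 2 then 1 else a) / N, ?_, ?_, ?_, ?_⟩
  · rw [euclNorm, sum_comp_commB l s (fun c => ((if c = 2 then 1 else a) / N) ^ 2)]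
    rw [Real.sqrt_eq_one]
    simpa using hnorm
  · rw [hm]
    ext i
    have hi := commB_le_two l i
    simp only [Matrix.mulVec, dotProduct, thetaB, Matrix.of_apply, Pi.smul_apply, smul_eq_mul]
    rw [sum_comp_commB l s (fun c => (if commB l i = c then p else q) *
      ((if c = 2 then 1 else a) / N))]
    generalize commB l i = c at *
    interval_cases c <;> simp <;> field_simp <;> linarith
  · refine Finset.sum_nonneg fun i _ => ?_
    rw [indGamma_eq_ite_commB]
    dsimp only
    split_ifs
    · positivity
    · simp
  · apply Real.sqrt_le_sqrt
    simp only [Pi.sub_apply, Pi.smul_apply, smul_eq_mul, indGamma_eq_ite_commB]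
    rw [sum_comp_commB l s (fun c => ((if c = 2 then 1 else a) / N -
      1 / R * (if c = 2 then 1 else 0)) ^ 2)]
    have h₁ : l * (a / N) ^ 2 + l * (a / N) ^ 2 + s * (1 / N - 1 / R) ^ 2 = 2 - 2 * (R / N) := by
      have h₂ : s * (1 / N - 1 / R) ^ 2 = s * (1 / N) ^ 2 - 2 * (R / N) + 1 := by
        rw [← hRsq]
        field_simp
        ring
      linarith
    have h₃ : R ≤ N := by
      refine (sq_le_sq₀ hR.le hNpos.le).mp ?_
      rw [hRsq, hNsq]
      linarith [show 0 ≤ 2 * l * a ^ 2 by positivity]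
    have h₄ : 2 - 2 * (R / N) ≤ 8 * s / l := by
      have h₅ : (R / N) ^ 2 ≤ R / N := by
        rw [sq]
        exact mul_le_of_le_one_left (by positivity) ((div_le_one hNpos).mpr h₃)
      have h₆ : 1 - (R / N) ^ 2 = 2 * l * a ^ 2 / N ^ 2 := by
        rw [div_pow, hRsq]
        field_simp
        linarith
      have h₇ : 2 * l * a ^ 2 / N ^ 2 ≤ s / l := by
        rw [div_le_div_iff₀ (by positivity) hl', hNsq]
        nlinarith [show 0 ≤ 2 * l * a ^ 2 * s by positivity]
      have h₈ : 0 < s / (l : ℝ) := by positivity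
      rw [mul_div_assoc]
      linarith
    simpa using h₁.le.trans h₄
end

section
/- Let Θ be the 3×3 matrix with diagonal entries p and off-diagonal entries q, let Δ = diag(√l, √l, √s), and let Z be the matrix obtained from ΔΘΔ by setting the (1,3), (2,3), (3,1), (3,2) entries to zero. The leading unit eigenvector of Z is u_1 = (1,1,0)/√2 with eigenvalue (p+q)l and spectral gap λ_1(Z) − λ_2(Z) = 2ql. If ũ_1 is a unit eigenvector of ΔΘΔ corresponding to its largest eigenvalue, with sign chosen so that ⟨ũ_1, u_1⟩ ≥ 0, then ||u_1 − ũ_1||_2 ≤ √(8 s / l). -/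
open Matrix

/-- The 3×3 block-parameter matrix `Θ` with `p` on the diagonal and `q` off it. -/
noncomputable def Theta3 (p q : ℝ) : Matrix (Fin 3) (Fin 3) ℝ :=
  Matrix.of fun i j => if i = j then p else q

/-- The diagonal matrix `Δ = diag(√l, √l, √s)`. -/
noncomputable def Delta3 (l s : ℕ) : Matrix (Fin 3) (Fin 3) ℝ :=
  Matrix.diagonal ![Real.sqrt l, Real.sqrt l, Real.sqrt s]

/-- `Z`: the matrix `ΔΘΔ` with the (1,3), (2,3), (3,1), (3,2) entries set to zero. -/
noncomputable def Zmat (p q : ℝ) (l s : ℕ) : Matrix (Fin 3) (Fin 3) ℝ :=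
  Matrix.of fun i j =>
    if i ≠ j ∧ (i = 2 ∨ j = 2) then 0 else (Delta3 l s * Theta3 p q * Delta3 l s) i j

theorem mergeSort_ofFn_eigenvalues_coe {n : ℕ} {A : Matrix (Fin n) (Fin n) ℝ}
    (hA : A.IsHermitian) :
    (((List.ofFn hA.eigenvalues).mergeSort (fun a b => decide (b ≤ a)) : List ℝ) : Multiset ℝ) =
      A.charpoly.roots := by
  rw [Multiset.coe_eq_coe.2 (List.mergeSort_perm _ _), hA.roots_charpoly_eq_eigenvalues]
  simp [← Fin.univ_val_map]

theorem pairwise_mergeSort_ge (L : List ℝ) :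
    (L.mergeSort (fun a b => decide (b ≤ a))).Pairwise (fun a b => b ≤ a) := by
  simpa using List.pairwise_mergeSort (le := fun a b : ℝ => decide (b ≤ a))
    (by simpa using fun a b c h₁ h₂ => le_trans h₂ h₁)
    (by simpa using fun a b : ℝ => le_total b a) L

/-- If the roots of the characteristic polynomial are listed in decreasing order, then
`kthLargestEig` reads off that list. -/
theorem kthLargestEig_eq_getD {n : ℕ} {A : Matrix (Fin n) (Fin n) ℝ} (hA : A.IsHermitian)
    {L : List ℝ} (hL : L.Pairwise (fun a b => b ≤ a)) (hroots : A.charpoly.roots = L) (k : ℕ) :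
    kthLargestEig A k = L.getD (k - 1) 0 := by
  have h : (List.ofFn hA.eigenvalues).mergeSort (fun a b => decide (b ≤ a)) = L :=
    List.Perm.eq_of_pairwise (fun a b _ _ h₁ h₂ => le_antisymm h₂ h₁)
      (pairwise_mergeSort_ge _) hL
      (Multiset.coe_eq_coe.1 ((mergeSort_ofFn_eigenvalues_coe hA).trans hroots))
  rw [kthLargestEig, dif_pos hA, h]

theorem le_kthLargestEig_one {n : ℕ} {A : Matrix (Fin n) (Fin n) ℝ} (hA : A.IsHermitian)
    {x : ℝ} (hx : A.charpoly.IsRoot x) : x ≤ kthLargestEig A 1 := by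
  have hmem : x ∈ (List.ofFn hA.eigenvalues).mergeSort (fun a b => decide (b ≤ a)) := by
    rw [← Multiset.mem_coe, mergeSort_ofFn_eigenvalues_coe hA,
      Polynomial.mem_roots A.charpoly_monic.ne_zero]
    exact hx
  have hsort := pairwise_mergeSort_ge (List.ofFn hA.eigenvalues)
  rw [kthLargestEig, dif_pos hA]
  generalize (List.ofFn hA.eigenvalues).mergeSort (fun a b => decide (b ≤ a)) = L at hmem hsort
  cases L with
  | nil => simp at hmem
  | cons a t =>
    rcases List.mem_cons.1 hmem with rfl | h
    · simp
    · simpa using (List.pairwise_cons.1 hsort).1 x h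

theorem Delta3_mul_Theta3_mul_Delta3 (p q : ℝ) (l s : ℕ) :
    Delta3 l s * Theta3 p q * Delta3 l s =
      !![p * l, q * l, q * (√l * √s); q * l, p * l, q * (√l * √s);
        q * (√l * √s), q * (√l * √s), p * s] := by
  have hl : √(l : ℝ) * √l = l := Real.mul_self_sqrt l.cast_nonneg
  have hs : √(s : ℝ) * √s = s := Real.mul_self_sqrt s.cast_nonneg
  ext i j
  fin_cases i <;> fin_cases j <;>
    simp [Delta3, Theta3, Matrix.mul_apply, Fin.sum_univ_three, Matrix.diagonal_apply] <;>
    first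
      | ring1
      | linear_combination p * hl
      | linear_combination q * hl
      | linear_combination p * hs

theorem Zmat_eq (p q : ℝ) (l s : ℕ) :
    Zmat p q l s = !![p * l, q * l, 0; q * l, p * l, 0; 0, 0, p * s] := by
  rw [Zmat, Delta3_mul_Theta3_mul_Delta3]
  ext i j
  fin_cases i <;> fin_cases j <;> simp

theorem roots_charpoly_Zmat (p q : ℝ) (l s : ℕ) :
    (Zmat p q l s).charpoly.roots =
      (([(p + q) * l, (p - q) * l, p * s] : List ℝ) : Multiset ℝ) := by
  have h : (Zmat p q l s).charpoly =
      ((([(p + q) * l, (p - q) * l, p * s] : List ℝ) : Multiset ℝ).map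
        fun a => Polynomial.X - Polynomial.C a).prod := by
    rw [Zmat_eq, Matrix.charpoly, Matrix.det_fin_three]
    simp
    ring
  rw [h, Polynomial.roots_multiset_prod_X_sub_C]

theorem isHermitian_Delta3_mul_Theta3_mul_Delta3 (p q : ℝ) (l s : ℕ) :
    (Delta3 l s * Theta3 p q * Delta3 l s).IsHermitian := by
  rw [Delta3_mul_Theta3_mul_Delta3]
  ext i j
  fin_cases i <;> fin_cases j <;> simp

theorem isHermitian_Zmat (p q : ℝ) (l s : ℕ) : (Zmat p q l s).IsHermitian := by
  rw [Zmat_eq]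
  ext i j
  fin_cases i <;> fin_cases j <;> simp

theorem le_kthLargestEig_Delta3_mul_Theta3_mul_Delta3 (p q : ℝ) (l s : ℕ) :
    (p + q) * l ≤ kthLargestEig (Delta3 l s * Theta3 p q * Delta3 l s) 1 := by
  set d : ℝ := ((p + q) * l - p * s) ^ 2 + 8 * q ^ 2 * (l * s) with hd
  have hd0 : 0 ≤ d := by positivity
  have hdle : (p + q) * l - p * s ≤ √d :=
    Real.le_sqrt_of_sq_le (le_add_of_nonneg_right (by positivity))
  refine le_trans (b := ((p + q) * l + p * s + √d) / 2) (by linarith)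
    (le_kthLargestEig_one (isHermitian_Delta3_mul_Theta3_mul_Delta3 p q l s) ?_)
  have hr : (√(l : ℝ) * √s) ^ 2 = l * s := by
    rw [mul_pow, Real.sq_sqrt l.cast_nonneg, Real.sq_sqrt s.cast_nonneg]
  have hquad : (((p + q) * l + p * s + √d) / 2 - (p + q) * l) *
      (((p + q) * l + p * s + √d) / 2 - p * s) = 2 * q ^ 2 * (l * s) := by
    linear_combination (Real.sq_sqrt hd0 + hd) / 4
  rw [Polynomial.IsRoot, Matrix.eval_charpoly, Delta3_mul_Theta3_mul_Delta3,
    Matrix.det_fin_three]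
  simp [Matrix.scalar_apply]
  linear_combination
    (((p + q) * l + p * s + √d) / 2 - (p - q) * l) * (hquad - 2 * q ^ 2 * hr)

/-- `u₁ = (1,1,0)/√2` is the unit leading eigenvector of `Z` with
eigenvalue `(p+q)l` and spectral gap `λ₁(Z) - λ₂(Z) = 2ql`; moreover any unit leading
eigenvector `ũ₁` of `ΔΘΔ` with `⟨ũ₁, u₁⟩ ≥ 0` satisfies `‖u₁ - ũ₁‖ ≤ √(8s/l)`. -/
theorem leading_eigenvector_of_DeltaThetaDelta (p q : ℝ) (l s : ℕ)
    (hq : 0 < q) (hpq : q < p) (hp : p ≤ 1) (hs : 0 < s) (hsl : s < l)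
    (hgap : p * s < (p - q) * l) :
    euclNorm ((1 / Real.sqrt 2) • ![(1 : ℝ), 1, 0]) = 1 ∧
    (Zmat p q l s).mulVec ((1 / Real.sqrt 2) • ![(1 : ℝ), 1, 0]) =
      ((p + q) * l) • ((1 / Real.sqrt 2) • ![(1 : ℝ), 1, 0]) ∧
    kthLargestEig (Zmat p q l s) 1 = (p + q) * l ∧
    kthLargestEig (Zmat p q l s) 1 - kthLargestEig (Zmat p q l s) 2 = 2 * q * l ∧
    (∀ u : Fin 3 → ℝ, euclNorm u = 1 →
      (Delta3 l s * Theta3 p q * Delta3 l s).mulVec u =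
        kthLargestEig (Delta3 l s * Theta3 p q * Delta3 l s) 1 • u →
      0 ≤ ∑ i, u i * ((1 / Real.sqrt 2) • ![(1 : ℝ), 1, 0]) i →
      euclNorm ((1 / Real.sqrt 2) • ![(1 : ℝ), 1, 0] - u) ≤
        Real.sqrt (8 * s / l)) := by
  have hl : (0 : ℝ) < l := by exact_mod_cast hs.trans hsl
  have hs' : (0 : ℝ) < s := by exact_mod_cast hs
  have h2 : √(2 : ℝ) ^ 2 = 2 := Real.sq_sqrt (by norm_num)
  have h2pos : 0 < √(2 : ℝ) := by positivity
  have hsort : [(p + q) * l, (p - q) * l, p * (s : ℝ)].Pairwise (fun a b => b ≤ a) := by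
    have : 0 < q * l := mul_pos hq hl
    simp
    refine ⟨⟨?_, ?_⟩, ?_⟩ <;> nlinarith
  have hk := kthLargestEig_eq_getD (isHermitian_Zmat p q l s) hsort (roots_charpoly_Zmat p q l s)
  refine ⟨?_, ?_, ?_, ?_, ?_⟩
  · simp [euclNorm, Fin.sum_univ_three]
    norm_num
  · rw [Zmat_eq]
    ext i
    fin_cases i <;> simp [Matrix.mulVec, dotProduct, Fin.sum_univ_three] <;> ring
  · simp [hk]
  · simp [hk]
    ring
  · intro u hu heig hinner
    have hμ := le_kthLargestEig_Delta3_mul_Theta3_mul_Delta3 p q l s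
    generalize kthLargestEig (Delta3 l s * Theta3 p q * Delta3 l s) 1 = μ at heig hμ
    rw [Delta3_mul_Theta3_mul_Delta3] at heig
    have e0 := congrFun heig 0
    have e1 := congrFun heig 1
    have e2 := congrFun heig 2
    simp [Matrix.mulVec, dotProduct, Fin.sum_univ_three] at e0 e1 e2
    rw [euclNorm, Real.sqrt_eq_one, Fin.sum_univ_three] at hu
    simp [Fin.sum_univ_three] at hinner
    have hab : u 0 = u 1 := by
      have h : (μ - (p - q) * l) * (u 0 - u 1) = 0 := by linear_combination e1 - e0
      have : 0 < q * l := mul_pos hq hl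
      rcases mul_eq_zero.1 h with h | h
      · nlinarith
      · linarith
    rw [← hab] at hu e2 hinner
    have ha : 0 ≤ u 0 := by
      have h : 0 ≤ (√2)⁻¹ * (u 0 + u 0) := by linarith
      have := nonneg_of_mul_nonneg_right h (by positivity)
      linarith
    have hgapμ : 2 * q * l ≤ μ - p * s := by nlinarith
    have hc : u 2 ^ 2 * l ≤ u 0 ^ 2 * s := by
      have hμc : (μ - p * s) * u 2 = 2 * q * (√l * √s) * u 0 := by linear_combination -e2
      have hsq : ((μ - p * s) * u 2) ^ 2 = (2 * q) ^ 2 * (l * s) * u 0 ^ 2 := by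
        rw [hμc]
        linear_combination (2 * q) ^ 2 * u 0 ^ 2 *
          (s * Real.sq_sqrt hl.le + √l ^ 2 * Real.sq_sqrt hs'.le)
      have hle : (2 * q * l) ^ 2 * u 2 ^ 2 ≤ ((μ - p * s) * u 2) ^ 2 := by
        rw [mul_pow (μ - p * s)]
        exact mul_le_mul_of_nonneg_right (pow_le_pow_left₀ (by positivity) hgapμ 2) (sq_nonneg _)
      refine le_of_mul_le_mul_left (a := (2 * q) ^ 2 * l) ?_ (by positivity)
      linarith
    refine Real.sqrt_le_sqrt ?_
    rw [le_div_iff₀ hl]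
    have hinv : (√2)⁻¹ = √2 / 2 := by field_simp; linarith
    simp [Fin.sum_univ_three, ← hab, hinv]
    have h1 : √2 * u 0 ≤ 1 := by nlinarith [sq_nonneg (u 2)]
    have h3 : (√2 / 2 - u 0) ^ 2 + (√2 / 2 - u 0) ^ 2 + u 2 ^ 2 ≤ 2 * u 2 ^ 2 := by
      nlinarith [mul_nonneg h2pos.le ha]
    nlinarith [sq_nonneg (u 2)]
end
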